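/- arXiv:1506.03717 — 2 statements merged into one kernel-verified Lean document; each statement's English description precedes it below -/
import Mathlib

section
/- Suppose u : ℤ × [0,1] → ℂ is a solution of the 1d discrete free Schrödinger equation ∂_t u_j = i(u_{j+1} − 2u_j + u_{j−1}) such that |u_j(0)| + |u_j(1)| ≤ C e^{−α j²} for all j ∈ ℤ, for some C > 0 and α > 0. Then there is a constant C₁ > 0 (independent of t) such that |u_j(t)| ≤ C₁ e^{−α j²} for all j ∈ ℤ and all t ∈ [0,1]. -/
open Real Complex

theorem baire_const (E : ℝ → ℝ)
    (hcl : ∀ c : ℝ, IsClosed {t | t ∈ Set.Icc (0:ℝ) 1 ∧ E t ≤ c})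
    (hA : ∀ s t, 0 ≤ s → s ≤ t → t ≤ 1 → (∃ M, ∀ x ∈ Set.Icc s t, E x ≤ M) → E s = E t) :
    ∀ t ∈ Set.Icc (0:ℝ) 1, E 0 = E t := by
  set B : Set ℝ → Prop := fun V => ∃ M, ∀ x ∈ V ∩ Set.Icc (0:ℝ) 1, E x ≤ M with hB
  set F : Set ℝ := {t | t ∈ Set.Icc (0:ℝ) 1 ∧ ∀ V ∈ nhds t, ¬ B V} with hF
  have hBmono : ∀ ⦃s t : Set ℝ⦄, s ⊆ t → B t → B s := by
    rintro s t hst ⟨M, hM⟩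
    exact ⟨M, fun x hx => hM x ⟨hst hx.1, hx.2⟩⟩
  have hcomp : ∀ s t, 0 ≤ s → t ≤ 1 → (∀ x ∈ Set.Icc s t, x ∉ F) →
      ∃ M, ∀ x ∈ Set.Icc s t, E x ≤ M := by
    intro s t hs ht hx
    have : B (Set.Icc s t) := by
      refine (isCompact_Icc).induction_on (p := B) ⟨0, by simp⟩ hBmono ?_ ?_
      · rintro a b ⟨M, hM⟩ ⟨N, hN⟩
        refine ⟨max M N, ?_⟩
        rintro x ⟨hx | hx, h1⟩
        · exact (hM x ⟨hx, h1⟩).trans (le_max_left _ _)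
        · exact (hN x ⟨hx, h1⟩).trans (le_max_right _ _)
      · intro x hxI
        have h1 := hx x hxI
        have hx01 : x ∈ Set.Icc (0:ℝ) 1 := ⟨hs.trans hxI.1, hxI.2.trans ht⟩
        have : ∃ V ∈ nhds x, B V := by
          by_contra hcon
          push Not at hcon
          exact h1 ⟨hx01, hcon⟩
        obtain ⟨V, hV, hBV⟩ := this
        exact ⟨V, mem_nhdsWithin_of_mem_nhds hV, hBV⟩
    obtain ⟨M, hM⟩ := this
    exact ⟨M, fun x hx => hM x ⟨hx, hs.trans hx.1, hx.2.trans ht⟩⟩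
  have hFclosed : IsClosed F := by
    have : F = Set.Icc (0:ℝ) 1 ∩ {t | ∃ V ∈ nhds t, B V}ᶜ := by
      ext t; simp [hF]
    rw [this]
    refine isClosed_Icc.inter (IsOpen.isClosed_compl ?_)
    rw [isOpen_iff_mem_nhds]
    rintro t ⟨V, hV, hBV⟩
    filter_upwards [eventually_mem_nhds_iff.2 hV] with y hy
    exact ⟨V, hy, hBV⟩
  have hFe : F = ∅ := by
    by_contra hne
    rw [← ne_eq, ← Set.nonempty_iff_ne_empty] at hne
    have : Nonempty F := hne.to_subtype
    have : CompleteSpace F := hFclosed.completeSpace_coe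
    obtain ⟨n, q, hq⟩ := nonempty_interior_of_iUnion_of_closed (X := F)
      (f := fun n : ℕ => {x : F | E x ≤ n})
      (by
        intro n
        have := (hcl n).preimage (continuous_subtype_val (p := fun x => x ∈ F))
        convert this using 1
        ext x
        simp only [Set.mem_ofPred_eq, Set.mem_preimage]
        exact ⟨fun h => ⟨x.2.1, h⟩, fun h => h.2⟩)
      (by
        ext x
        simp only [Set.mem_iUnion, Set.mem_ofPred_eq, Set.mem_univ, iff_true]
        exact exists_nat_ge _)
    rw [mem_interior_iff_mem_nhds, Metric.mem_nhds_iff] at hq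
    obtain ⟨ε, hε, hball⟩ := hq
    have hFn : ∀ a ∈ F, |a - q| < ε → E a ≤ n := by
      intro a ha hd
      have : (⟨a, ha⟩ : F) ∈ Metric.ball q ε := by
        rw [Metric.mem_ball, Subtype.dist_eq, Real.dist_eq]; exact hd
      exact hball this
    have hq01 := q.2.1
    refine q.2.2 (Metric.ball (q:ℝ) ε) (Metric.ball_mem_nhds _ hε) ⟨n, ?_⟩
    rintro t ⟨htb, ht01⟩
    rw [Metric.mem_ball, Real.dist_eq] at htb
    by_cases htF : t ∈ F
    · exact hFn t htF htb
    rcases le_total t q with htq | htq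
    · -- nearest point of F to the right
      have hK : IsCompact (F ∩ Set.Icc t q) := isCompact_Icc.inter_left hFclosed
      obtain ⟨a, ⟨haF, hat, haq⟩, hmin⟩ := hK.exists_isLeast ⟨q, q.2, htq, le_refl _⟩
      have hbd : ∀ s ∈ Set.Icc t a, E s ≤ max (E t) (E a) := by
        intro s hs
        rcases eq_or_lt_of_le hs.2 with h | h
        · rw [h]; exact le_max_right _ _
        · have := hA t s ht01.1 hs.1 (hs.2.trans haF.1.2)
            (hcomp t s ht01.1 (hs.2.trans haF.1.2) (by
              intro x hx hxF
              have := hmin ⟨hxF, hx.1, (hx.2.trans hs.2).trans haq⟩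
              linarith [hx.2]))
          rw [← this]; exact le_max_left _ _
      rw [hA t a ht01.1 hat haF.1.2 ⟨_, hbd⟩]
      apply hFn a haF
      rw [abs_lt] at htb ⊢
      constructor <;> linarith
    · have hK : IsCompact (F ∩ Set.Icc (q:ℝ) t) := isCompact_Icc.inter_left hFclosed
      obtain ⟨a, ⟨haF, haq, hat⟩, hmax⟩ := hK.exists_isGreatest ⟨q, q.2, le_refl _, htq⟩
      have hbd : ∀ s ∈ Set.Icc a t, E s ≤ max (E t) (E a) := by
        intro s hs
        rcases eq_or_lt_of_le hs.1 with h | h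
        · rw [← h]; exact le_max_right _ _
        · have := hA s t (haF.1.1.trans hs.1) hs.2 ht01.2
            (hcomp s t (haF.1.1.trans hs.1) ht01.2 (by
              intro x hx hxF
              have := hmax ⟨hxF, haq.trans (hs.1.trans hx.1), hx.2⟩
              linarith [hx.1]))
          rw [this]; exact le_max_left _ _
      rw [← hA a t haF.1.1 hat ht01.2 ⟨_, hbd⟩]
      apply hFn a haF
      rw [abs_lt] at htb ⊢
      constructor <;> linarith
  intro t ht
  exact hA 0 t le_rfl ht.1 ht.2 (hcomp 0 t le_rfl ht.2 (by simp [hFe]))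


theorem dls_unique
    (u : ℤ → ℝ → ℂ)
    (hl2 : ∀ t ∈ Set.Icc (0:ℝ) 1, Summable fun j : ℤ => ‖u j t‖ ^ 2)
    (hode : ∀ (j : ℤ), ∀ t ∈ Set.Icc (0:ℝ) 1,
      HasDerivAt (u j) (Complex.I * (u (j + 1) t - 2 * u j t + u (j - 1) t)) t)
    (h0 : ∀ j, u j 0 = 0) : ∀ j, ∀ t ∈ Set.Icc (0:ℝ) 1, u j t = 0 := by
  set q : ℕ → ℝ → ℝ := fun i t => ‖u i t‖ ^ 2 + ‖u (-(i:ℤ) - 1) t‖ ^ 2 with hq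
  set E : ℝ → ℝ := fun t => ∑' i, q i t with hE
  have hqn : ∀ i t, 0 ≤ q i t := fun i t => by positivity
  have hs : ∀ t ∈ Set.Icc (0:ℝ) 1, Summable fun i => q i t := by
    intro t ht
    refine Summable.add ?_ ?_
    · exact (hl2 t ht).comp_injective (i := fun n : ℕ => (n:ℤ)) (fun a b h => by simpa using h)
    · exact (hl2 t ht).comp_injective (i := fun n : ℕ => -(n:ℤ) - 1)
        (fun a b h => by simpa using h)
  have huE : ∀ j, ∀ t ∈ Set.Icc (0:ℝ) 1, ‖u j t‖ ^ 2 ≤ E t := by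
    intro j t ht
    rcases le_or_gt 0 j with hj | hj
    · lift j to ℕ using hj
      have := (hs t ht).le_tsum j (fun i _ => hqn i t)
      refine le_trans ?_ this
      simp only [hq]
      linarith [sq_nonneg ‖u (-(j:ℤ) - 1) t‖]
    · obtain ⟨k, hk⟩ : ∃ k : ℕ, j = -(k:ℤ) - 1 := ⟨(-j-1).toNat, by omega⟩
      have := (hs t ht).le_tsum k (fun i _ => hqn i t)
      refine le_trans ?_ this
      simp only [hq, hk]
      linarith [sq_nonneg ‖u (k:ℤ) t‖]
  set f : ℤ → ℝ → ℝ := fun k t => 2 * ((starRingEnd ℂ) (u k t) * u (k+1) t).im with hf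
  set G : ℕ → ℝ → ℝ := fun n t => f (-(n:ℤ) - 1) t - f ((n:ℤ) - 1) t with hG
  have hd1 : ∀ k, ∀ t ∈ Set.Icc (0:ℝ) 1,
      HasDerivAt (fun t => ‖u k t‖ ^ 2) (f (k-1) t - f k t) t := by
    intro k t ht
    have h := (hode k t ht).norm_sq
    convert h using 1
    simp only [hf, Complex.inner, sub_add_cancel, Complex.mul_im, Complex.mul_re, Complex.conj_re,
      Complex.conj_im, Complex.I_re, Complex.I_im, Complex.add_re, Complex.add_im, Complex.sub_re,
      Complex.sub_im, Complex.re_ofNat, Complex.im_ofNat]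
    ring
  have hd2 : ∀ n : ℕ, ∀ t ∈ Set.Icc (0:ℝ) 1,
      HasDerivAt (fun t => ∑ i ∈ Finset.range n, q i t) (G n t) t := by
    intro n t ht
    have h : HasDerivAt (fun t => ∑ i ∈ Finset.range n, q i t)
        (∑ i ∈ Finset.range n, (G (i+1) t - G i t)) t := by
      refine HasDerivAt.fun_sum fun i _ => ?_
      refine ((hd1 i t ht).fun_add (hd1 (-(i:ℤ) - 1) t ht)).congr_deriv ?_
      simp only [hG]
      push_cast
      rw [show -((i:ℤ)+1) - 1 = -(i:ℤ) - 1 - 1 by ring, show (i:ℤ) + 1 - 1 = i by ring]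
      ring
    rw [Finset.sum_range_sub (fun i => G i t)] at h
    convert h using 1
    simp [hG]
  have hcont : ∀ j, ContinuousOn (u j) (Set.Icc 0 1) :=
    fun j t ht => (hode j t ht).continuousAt.continuousWithinAt
  have hfc : ∀ j, ContinuousOn (f j) (Set.Icc 0 1) := by
    intro j
    simp only [hf]
    refine continuousOn_const.mul (Complex.continuous_im.comp_continuousOn ?_)
    exact (Complex.continuous_conj.comp_continuousOn (hcont j)).mul (hcont (j+1))
  have hGc : ∀ n, ContinuousOn (G n) (Set.Icc 0 1) := fun n => (hfc _).sub (hfc _)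
  have hfb : ∀ j, ∀ t ∈ Set.Icc (0:ℝ) 1, |f j t| ≤ ‖u j t‖^2 + ‖u (j+1) t‖^2 := by
    intro j t ht
    simp only [hf, abs_mul, abs_two]
    have := Complex.abs_im_le_norm ((starRingEnd ℂ) (u j t) * u (j+1) t)
    rw [norm_mul, RCLike.norm_conj] at this
    nlinarith [sq_nonneg (‖u j t‖ - ‖u (j+1) t‖)]
  have hGb : ∀ n, ∀ t ∈ Set.Icc (0:ℝ) 1, ‖G n t‖ ≤ 4 * E t := by
    intro n t ht
    have h1 := hfb (-(n:ℤ)-1) t ht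
    have h2 := hfb ((n:ℤ)-1) t ht
    have := abs_sub (f (-(n:ℤ) - 1) t) (f ((n:ℤ) - 1) t)
    rw [Real.norm_eq_abs]
    linarith [huE (-(n:ℤ)-1) t ht, huE (-(n:ℤ)-1+1) t ht, huE ((n:ℤ)-1) t ht, huE ((n:ℤ)-1+1) t ht]
  have hG0 : ∀ t ∈ Set.Icc (0:ℝ) 1, Filter.Tendsto (fun n => G n t) Filter.atTop (nhds 0) := by
    intro t ht
    have hz : Filter.Tendsto (fun j => ‖u j t‖^2 + ‖u (j+1) t‖^2) Filter.cofinite (nhds 0) := by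
      have h1 := (hl2 t ht).tendsto_cofinite_zero
      have h2 := h1.comp ((add_left_injective (1:ℤ)).tendsto_cofinite)
      simpa using h1.add h2
    have hfz : Filter.Tendsto (fun j => f j t) Filter.cofinite (nhds 0) :=
      squeeze_zero_norm (fun j => hfb j t ht) hz
    have ha : Filter.Tendsto (fun n : ℕ => f (-(n:ℤ) - 1) t) Filter.atTop (nhds 0) := by
      rw [← Nat.cofinite_eq_atTop]
      exact hfz.comp (Function.Injective.tendsto_cofinite (f := fun n : ℕ => -(n:ℤ) - 1)
        (fun a b h => by simpa using h))
    have hb : Filter.Tendsto (fun n : ℕ => f ((n:ℤ) - 1) t) Filter.atTop (nhds 0) := by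
      rw [← Nat.cofinite_eq_atTop]
      exact hfz.comp (Function.Injective.tendsto_cofinite (f := fun n : ℕ => (n:ℤ) - 1)
        (fun a b h => by simpa using h))
    simpa using ha.sub hb
  have hconst := baire_const E ?_ ?_
  · intro j t ht
    have h1 := huE j t ht
    rw [← hconst t ht] at h1
    have : E 0 = 0 := by simp [hE, hq, h0]
    rw [this] at h1
    have : ‖u j t‖ = 0 := by nlinarith [norm_nonneg (u j t)]
    exact norm_eq_zero.1 this
  · intro c
    have : {t | t ∈ Set.Icc (0:ℝ) 1 ∧ E t ≤ c} =
        ⋂ n : ℕ, Set.Icc (0:ℝ) 1 ∩ (fun t => ∑ i ∈ Finset.range n, q i t) ⁻¹' Set.Iic c := by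
      ext t
      simp only [Set.mem_ofPred_eq, Set.mem_iInter, Set.mem_inter_iff, Set.mem_preimage, Set.mem_Iic]
      constructor
      · rintro ⟨ht, h⟩ n
        exact ⟨ht, ((hs t ht).sum_le_tsum _ (fun i _ => hqn i t)).trans h⟩
      · intro h
        exact ⟨(h 0).1, le_of_tendsto' (hs t (h 0).1).hasSum.tendsto_sum_nat (fun n => (h n).2)⟩
    rw [this]
    refine isClosed_iInter fun n => ?_
    exact ContinuousOn.preimage_isClosed_of_isClosed
      (fun t ht => (hd2 n t ht).continuousAt.continuousWithinAt) isClosed_Icc isClosed_Iic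
  · rintro s t hs0 hst ht1 ⟨M, hM⟩
    have hsub : Set.Icc s t ⊆ Set.Icc 0 1 := Set.Icc_subset_Icc hs0 ht1
    have hI : Filter.Tendsto (fun n => ∫ x in s..t, G n x) Filter.atTop
        (nhds (∫ x in s..t, (0:ℝ))) := by
      refine intervalIntegral.tendsto_integral_filter_of_dominated_convergence (fun _ => 4 * M)
        ?_ ?_ ?_ ?_
      · refine Filter.Eventually.of_forall fun n => ?_
        rw [Set.uIoc_of_le hst]
        exact ((hGc n).mono (Set.Ioc_subset_Icc_self.trans hsub)).aestronglyMeasurable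
          measurableSet_Ioc
      · refine Filter.Eventually.of_forall fun n => Filter.Eventually.of_forall fun x hx => ?_
        rw [Set.uIoc_of_le hst] at hx
        have hx' := Set.Ioc_subset_Icc_self hx
        linarith [hGb n x (hsub hx'), hM x hx']
      · exact intervalIntegrable_const
      · refine Filter.Eventually.of_forall fun x hx => ?_
        rw [Set.uIoc_of_le hst] at hx
        exact hG0 x (hsub (Set.Ioc_subset_Icc_self hx))
    have heq : ∀ n, ∫ x in s..t, G n x =
        (∑ i ∈ Finset.range n, q i t) - ∑ i ∈ Finset.range n, q i s := by
      intro n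
      refine intervalIntegral.integral_eq_sub_of_hasDerivAt
        (f := fun t => ∑ i ∈ Finset.range n, q i t) ?_ ?_
      · intro x hx
        rw [Set.uIcc_of_le hst] at hx
        exact hd2 n x (hsub hx)
      · refine ContinuousOn.intervalIntegrable ?_
        rw [Set.uIcc_of_le hst]
        exact (hGc n).mono hsub
    simp only [heq, intervalIntegral.integral_zero] at hI
    have h2 := ((hs t (hsub ⟨hst, le_rfl⟩)).hasSum.tendsto_sum_nat).sub
      ((hs s (hsub ⟨le_rfl, hst⟩)).hasSum.tendsto_sum_nat)
    have := tendsto_nhds_unique hI h2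
    simp only [hE]
    linarith

theorem coeff_bound (c : ℤ → ℂ) (hc : Summable fun k => ‖c k‖) (K : ℝ)
    (hK : ∀ x : ℝ, ‖∑' k : ℤ, c k * Complex.exp (k * (x * Complex.I))‖ ≤ K) (j : ℤ) :
    ‖c j‖ ≤ K := by
  have hnorm : ∀ (k : ℤ) (x : ℝ), ‖Complex.exp (k * (x * Complex.I))‖ = 1 := by
    intro k x
    have := Complex.norm_exp_ofReal_mul_I (k * x)
    rw [← this]; congr 2; push_cast; ring
  have hsum : ∀ x : ℝ, Summable fun k : ℤ => c k * Complex.exp (k * (x * Complex.I)) := by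
    intro x
    refine Summable.of_norm ?_
    simpa [norm_mul, hnorm] using hc
  have hI := intervalIntegral.hasSum_integral_of_dominated_convergence (ι := ℤ) (a := 0)
    (b := 2 * π) (μ := MeasureTheory.volume)
    (F := fun k (x:ℝ) => c k * Complex.exp (k * (x * Complex.I)) * Complex.exp ((-j:ℤ) * (x * Complex.I)))
    (f := fun x : ℝ => (∑' k : ℤ, c k * Complex.exp (k * (x * Complex.I))) * Complex.exp ((-j:ℤ) * (x * Complex.I)))
    (fun k _ => ‖c k‖)
    (fun k => by
      apply Continuous.aestronglyMeasurable
      fun_prop)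
    (fun k => Filter.Eventually.of_forall fun x _ => by
      rw [norm_mul, norm_mul, hnorm, hnorm]; simp)
    (Filter.Eventually.of_forall fun x _ => hc)
    intervalIntegrable_const
    (Filter.Eventually.of_forall fun x _ => (hsum x).hasSum.mul_right _)
  have hval : ∀ k : ℤ, ∫ x in (0:ℝ)..(2*π), c k * Complex.exp (k * (x * Complex.I)) * Complex.exp ((-j:ℤ) * (x * Complex.I)) = if k = j then 2 * π * c j else 0 := by
    intro k
    have h1 : ∀ x : ℝ, c k * Complex.exp (k * (x * Complex.I)) * Complex.exp ((-j:ℤ) * (x * Complex.I))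
        = c k * Complex.exp (((k - j : ℤ) * Complex.I) * x) := by
      intro x
      rw [mul_assoc, ← Complex.exp_add]
      congr 2; push_cast; ring
    simp only [h1]
    rw [intervalIntegral.integral_const_mul]
    split_ifs with h
    · subst h; simp; ring
    · have hne : (((k - j : ℤ) : ℂ) * Complex.I) ≠ 0 := by
        refine mul_ne_zero ?_ Complex.I_ne_zero
        exact_mod_cast sub_ne_zero.2 h
      rw [integral_exp_mul_complex hne]
      have : ((k - j : ℤ) : ℂ) * Complex.I * ((2 * π : ℝ) : ℂ) = (k - j : ℤ) * (2 * π * Complex.I) := by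
        push_cast; ring
      rw [this, Complex.exp_int_mul_two_pi_mul_I]
      simp
  simp only [hval] at hI
  have h2 := hI.unique (hasSum_ite_eq j (2 * (π:ℂ) * c j))
  have h3 := intervalIntegral.norm_integral_le_of_norm_le_const (a := 0) (b := 2 * π) (C := K)
    (f := fun x : ℝ => (∑' k : ℤ, c k * Complex.exp (k * (x * Complex.I))) * Complex.exp ((-j:ℤ) * (x * Complex.I)))
    (fun x _ => by rw [norm_mul, hnorm, mul_one]; exact hK x)
  rw [h2, norm_mul, norm_mul, sub_zero, abs_of_pos Real.two_pi_pos] at h3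
  simp only [Complex.norm_ofNat, Complex.norm_real, Real.norm_eq_abs, abs_of_pos Real.pi_pos] at h3
  have := Real.two_pi_pos
  by_contra hcon
  push Not at hcon
  nlinarith

theorem l1_summable (v : lp (fun _ : ℤ => ℂ) 1) : Summable fun k => ‖v k‖ := by
  simpa using (lp.memℓp v).summable (by simp)

theorem exists_wshift (a : ℤ → ℂ) (B : ℝ) (hB : ∀ k, ‖a k‖ ≤ B) (e : ℤ ≃ ℤ) :
    ∃ T : lp (fun _ : ℤ => ℂ) 1 →L[ℂ] lp (fun _ : ℤ => ℂ) 1, ∀ v k, T v k = a k * v (e k) := by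
  have hB0 : 0 ≤ B := (norm_nonneg _).trans (hB 0)
  have hle : ∀ (v : lp (fun _ : ℤ => ℂ) 1) k, ‖a k * v (e k)‖ ≤ B * ‖v (e k)‖ := fun v k => by
    rw [norm_mul]; exact mul_le_mul_of_nonneg_right (hB k) (norm_nonneg _)
  have hs : ∀ v : lp (fun _ : ℤ => ℂ) 1, Summable fun k => B * ‖v (e k)‖ := fun v =>
    ((l1_summable v).comp_injective e.injective).mul_left B
  have hs' : ∀ v : lp (fun _ : ℤ => ℂ) 1, Summable fun k => ‖a k * v (e k)‖ := fun v =>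
    Summable.of_nonneg_of_le (fun _ => norm_nonneg _) (hle v) (hs v)
  have hm : ∀ v : lp (fun _ : ℤ => ℂ) 1, Memℓp (fun k => a k * v (e k)) 1 := fun v =>
    memℓp_gen (by simpa using hs' v)
  let L : lp (fun _ : ℤ => ℂ) 1 →ₗ[ℂ] lp (fun _ : ℤ => ℂ) 1 :=
    { toFun := fun v => ⟨fun k => a k * v (e k), hm v⟩
      map_add' := fun v w => by
        ext k
        change a k * (v (e k) + w (e k)) = a k * v (e k) + a k * w (e k)
        ring
      map_smul' := fun c v => by
        ext k
        change a k * (c * v (e k)) = c * (a k * v (e k))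
        ring }
  have hL : ∀ v k, L v k = a k * v (e k) := fun v k => rfl
  refine ⟨L.mkContinuous B ?_, fun v k => rfl⟩
  intro v
  have h1 : ∀ w : lp (fun _ : ℤ => ℂ) 1, ‖w‖ = ∑' k, ‖w k‖ := fun w => by
    simpa using lp.norm_eq_tsum_rpow (p := 1) (by simp) w
  rw [h1, h1, ← e.tsum_eq (fun k => ‖v k‖), ← tsum_mul_left]
  exact Summable.tsum_le_tsum (hle v) (hs' v) (hs v)

theorem tsum_shift (g : ℤ → ℂ) (hgs : Summable g) (z : ℂ) :
    ∑' k, Complex.I * (z⁻¹ * g (k+1) - 2 * g k + z * g (k-1)) =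
      Complex.I * (z⁻¹ * (∑' k, g k) - 2 * (∑' k, g k) + z * ∑' k, g k) := by
  have hp : HasSum (fun k => g (k+1)) (∑' k, g k) :=
    (Equiv.addRight (1:ℤ)).hasSum_iff.2 hgs.hasSum
  have hm : HasSum (fun k => g (k-1)) (∑' k, g k) :=
    (Equiv.subRight (1:ℤ)).hasSum_iff.2 hgs.hasSum
  exact ((((hp.mul_left z⁻¹).sub (hgs.hasSum.mul_left 2)).add (hm.mul_left z)).mul_left
    Complex.I).tsum_eq

set_option maxHeartbeats 1000000 in
theorem exists_solution (σ : ℝ) (hσ : 0 ≤ σ) (u0 : ℤ → ℂ)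
    (hu0 : Summable fun k : ℤ => Real.exp (σ * |(k:ℝ)|) * ‖u0 k‖) :
    ∃ w : ℤ → ℝ → ℂ, (∀ k, w k 0 = u0 k) ∧
      (∀ j t, HasDerivAt (w j) (Complex.I * (w (j + 1) t - 2 * w j t + w (j - 1) t)) t) ∧
      (∀ t, Summable fun k : ℤ => Real.exp (σ * |(k:ℝ)|) * ‖w k t‖) ∧
      (∀ z : ℂ, z ≠ 0 → (∀ k : ℤ, ‖z ^ k‖ ≤ Real.exp (σ * |(k:ℝ)|)) → ∀ t : ℝ,
        ∑' k : ℤ, z ^ k * w k t =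
          Complex.exp (t * (Complex.I * (z + z⁻¹ - 2))) * ∑' k : ℤ, z ^ k * u0 k) := by
  set ω : ℤ → ℝ := fun k => Real.exp (σ * |(k:ℝ)|) with hω
  have hωpos : ∀ k, 0 < ω k := fun k => Real.exp_pos _
  have hωne : ∀ k, (ω k : ℂ) ≠ 0 := fun k => by exact_mod_cast (hωpos k).ne'
  have hratio : ∀ k l : ℤ, |(k:ℝ) - l| ≤ 1 → ‖(ω k / ω l : ℂ)‖ ≤ Real.exp σ := by
    intro k l hkl
    rw [← Complex.ofReal_div, Complex.norm_real, Real.norm_of_nonneg (by positivity)]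
    simp only [hω]
    rw [← Real.exp_sub]
    apply Real.exp_le_exp.2
    have := abs_sub_abs_le_abs_sub (k:ℝ) l
    nlinarith
  obtain ⟨Tp, hTp⟩ := exists_wshift (fun k => ω k / ω (k+1)) (Real.exp σ)
    (fun k => hratio k (k+1) (by push_cast; simp)) (Equiv.addRight 1)
  obtain ⟨Tm, hTm⟩ := exists_wshift (fun k => ω k / ω (k-1)) (Real.exp σ)
    (fun k => hratio k (k-1) (by push_cast; simp)) (Equiv.subRight 1)
  set A : lp (fun _ : ℤ => ℂ) 1 →L[ℂ] lp (fun _ : ℤ => ℂ) 1 :=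
    Complex.I • (Tp - (2:ℂ) • ContinuousLinearMap.id ℂ _ + Tm) with hA
  have hAv : ∀ v k, A v k = Complex.I * (ω k / ω (k+1) * v (k+1) - 2 * v k
      + ω k / ω (k-1) * v (k-1)) := by
    intro v k
    have : A v k = Complex.I * (Tp v k - 2 * v k + Tm v k) := rfl
    rw [this, hTp, hTm]; rfl
  let v0 : lp (fun _ : ℤ => ℂ) 1 := ⟨fun k => ω k * u0 k, memℓp_gen (by
    simpa [hω, Complex.norm_real, abs_of_pos, Real.exp_pos, Complex.norm_exp] using hu0)⟩
  have hv0 : ∀ k, v0 k = ω k * u0 k := fun k => rfl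
  set V : ℝ → lp (fun _ : ℤ => ℂ) 1 := fun t => NormedSpace.exp (t • A) v0 with hV
  have hV0 : V 0 = v0 := by simp [hV, NormedSpace.exp_zero]
  have hVd : ∀ t, HasDerivAt V (A (V t)) t := by
    intro t
    have h := hasDerivAt_exp_smul_const' (𝕂 := ℝ) A t
    have h2 := ((ContinuousLinearMap.apply ℂ (lp (fun _ : ℤ => ℂ) 1) v0).restrictScalars ℝ).hasFDerivAt.comp_hasDerivAt t h
    exact h2
  have hfun : ∀ (φ : lp (fun _ : ℤ => ℂ) 1 →L[ℂ] ℂ) t, HasDerivAt (fun t => φ (V t)) (φ (A (V t))) t :=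
    fun φ t => (φ.restrictScalars ℝ).hasFDerivAt.comp_hasDerivAt t (hVd t)
  refine ⟨fun k t => V t k / ω k, ?_, ?_, ?_, ?_⟩
  · intro k
    have h1 := hωne k
    change V 0 k / ω k = u0 k
    rw [hV0, hv0]
    field_simp
  · intro j t
    have h := (hfun (lp.evalCLM ℂ (fun _ : ℤ => ℂ) 1 j) t).div_const (ω j : ℂ)
    refine h.congr_deriv ?_
    change A (V t) j / ω j = _
    rw [hAv]
    have h1 := hωne j
    have h2 := hωne (j+1)
    have h3 := hωne (j-1)
    field_simp
  · intro t
    refine (l1_summable (V t)).congr fun k => ?_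
    rw [norm_div, Complex.norm_real, Real.norm_of_nonneg (hωpos k).le]
    change _ = ω k * (‖V t k‖ / ω k)
    have := (hωpos k).ne'
    field_simp
  · intro z hz hzk t
    obtain ⟨S, hS⟩ := exists_wshift (fun k => z ^ k / ω k) 1 (fun k => by
      rw [norm_div, Complex.norm_real, Real.norm_of_nonneg (hωpos k).le, div_le_one (hωpos k)]
      exact hzk k) (Equiv.refl ℤ)
    set φ : lp (fun _ : ℤ => ℂ) 1 →L[ℂ] ℂ := (lp.tsumCLM ℂ ℤ ℂ).comp S with hφ
    have hφv : ∀ v, φ v = ∑' k : ℤ, z ^ k / ω k * v k := by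
      intro v
      have : φ v = ∑' k, S v k := rfl
      rw [this]
      simp only [hS, Equiv.refl_apply]
    have hsm : ∀ v : lp (fun _ : ℤ => ℂ) 1, Summable fun k : ℤ => z ^ k / ω k * v k := by
      intro v
      exact (l1_summable (S v)).of_norm.congr (fun k => hS v k)
    set lam := Complex.I * (z + z⁻¹ - 2) with hlam
    have hφA : ∀ v, φ (A v) = lam * φ v := by
      intro v
      rw [hφv, hφv]
      set g : ℤ → ℂ := fun k => z ^ k / ω k * v k with hg
      have hgs : Summable g := hsm v
      have h1 : ∀ k : ℤ, z ^ k / ω k * A v k = Complex.I * (z⁻¹ * g (k+1) - 2 * g k + z * g (k-1)) := by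
        intro k
        rw [hAv]
        simp only [hg]
        rw [zpow_add_one₀ hz, zpow_sub_one₀ hz]
        have h1 := hωne k
        have h2 := hωne (k+1)
        have h3 := hωne (k-1)
        field_simp
      simp only [h1]
      rw [tsum_shift g hgs z]
      simp only [hlam]; ring
    have hD : ∀ t : ℝ, HasDerivAt (fun t : ℝ => Complex.exp (-(t * lam)) * φ (V t)) 0 t := by
      intro t
      have h1 : HasDerivAt (fun t : ℝ => Complex.exp (-(t * lam)))
          (Complex.exp (-(t * lam)) * (-(1 * lam))) t :=
        ((((hasDerivAt_id (t:ℂ)).comp_ofReal).mul_const lam).neg).cexp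
      refine (h1.mul (hfun φ t)).congr_deriv ?_
      rw [hφA]; ring
    have hconst := is_const_of_deriv_eq_zero (fun t => (hD t).differentiableAt) (fun t => (hD t).deriv) t 0
    simp only [Complex.ofReal_zero, zero_mul, neg_zero, Complex.exp_zero, one_mul, hV0] at hconst
    have e1 : φ (V t) = ∑' k : ℤ, z ^ k * (V t k / ω k) := by
      rw [hφv]; congr 1; ext k; ring
    have e2 : φ v0 = ∑' k : ℤ, z ^ k * u0 k := by
      rw [hφv]; congr 1; ext k; rw [hv0]
      have h1 := hωne k
      field_simp
    rw [← e1, ← e2, ← hconst, ← mul_assoc, ← Complex.exp_add]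
    simp

theorem summable_gauss (α : ℝ) (hα : 0 < α) :
    Summable fun k : ℤ => Real.exp (-α * (k:ℝ) ^ 2) := by
  have hN : Summable fun n : ℕ => Real.exp (-α * (n:ℝ) ^ 2) := by
    have hg : Summable fun n : ℕ => Real.exp (-α) ^ n :=
      summable_geometric_of_lt_one (Real.exp_pos _).le (by rw [Real.exp_lt_one_iff]; linarith)
    refine Summable.of_nonneg_of_le (fun _ => (Real.exp_pos _).le) (fun n => ?_) hg
    rw [← Real.exp_nat_mul]
    apply Real.exp_le_exp.2
    have : (n:ℝ) ≤ (n:ℝ)^2 := by exact_mod_cast Nat.le_self_pow two_ne_zero n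
    nlinarith
  refine Summable.of_nat_of_neg ?_ ?_
  · simpa using hN
  · simpa using hN

theorem gaussian_bound_interior
    (u : ℤ → ℝ → ℂ) (C α : ℝ) (hC : 0 < C) (hα : 0 < α)
    (hl2 : ∀ t ∈ Set.Icc (0:ℝ) 1, Summable fun j : ℤ => ‖u j t‖ ^ 2)
    (hode : ∀ (j : ℤ), ∀ t ∈ Set.Icc (0:ℝ) 1,
      HasDerivAt (u j) (Complex.I * (u (j + 1) t - 2 * u j t + u (j - 1) t)) t)
    (hdecay : ∀ j : ℤ, ‖u j 0‖ + ‖u j 1‖ ≤ C * Real.exp (-α * (j : ℝ) ^ 2)) :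
    ∃ C₁ > 0, ∀ (j : ℤ), ∀ t ∈ Set.Icc (0:ℝ) 1,
      ‖u j t‖ ≤ C₁ * Real.exp (-α * (j : ℝ) ^ 2) := by
  have hgs := summable_gauss α hα
  set S : ℝ := ∑' k : ℤ, Real.exp (-α * (k:ℝ) ^ 2) with hS
  have hSpos : 0 < S := hgs.tsum_pos (fun _ => (Real.exp_pos _).le) 0 (Real.exp_pos _)
  refine ⟨C * S, by positivity, ?_⟩
  intro j t ht
  -- shifted Gaussian sums
  have hshift : ∀ j : ℤ, HasSum (fun k : ℤ => Real.exp (2 * α * j * k) * (C * Real.exp (-α * (k:ℝ) ^ 2)))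
      (C * (Real.exp (α * (j:ℝ) ^ 2) * S)) := by
    intro j
    have h := ((Equiv.subRight j).hasSum_iff.2 hgs.hasSum).mul_left (C * Real.exp (α * (j:ℝ) ^ 2))
    rw [mul_assoc] at h
    refine h.congr_fun ?_
    intro k
    simp only [Function.comp, Equiv.subRight_apply]
    rw [mul_assoc C, mul_left_comm, ← Real.exp_add, ← Real.exp_add]
    congr 2
    push_cast; ring
  set σ : ℝ := 2 * α * |(j:ℝ)| with hσ
  have hσ0 : 0 ≤ σ := by positivity
  have hu0 : Summable fun k : ℤ => Real.exp (σ * |(k:ℝ)|) * ‖u k 0‖ := by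
    refine Summable.of_nonneg_of_le (fun k => by positivity) (fun k => ?_)
      ((hshift j).summable.add (hshift (-j)).summable)
    have h1 : ‖u k 0‖ ≤ C * Real.exp (-α * (k:ℝ) ^ 2) := by
      linarith [hdecay k, norm_nonneg (u k 1)]
    have h2 : Real.exp (σ * |(k:ℝ)|) ≤ Real.exp (2 * α * j * k) + Real.exp (2 * α * (-j : ℤ) * k) := by
      have : σ * |(k:ℝ)| = |2 * α * j * k| := by
        rw [abs_mul, abs_mul, abs_of_pos (by positivity : 0 < 2 * α)]
      rw [this]
      rcases abs_choice (2 * α * (j:ℝ) * k) with h | h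
      · rw [h]; linarith [Real.exp_pos (2 * α * (-j : ℤ) * k)]
      · rw [h, show -(2 * α * (j:ℝ) * k) = 2 * α * (-j : ℤ) * k by push_cast; ring]
        linarith [Real.exp_pos (2 * α * j * k)]
    rw [← add_mul]
    exact mul_le_mul h2 h1 (norm_nonneg _) (by positivity)
  obtain ⟨w, hw0, hwode, hws, hwz⟩ := exists_solution σ hσ0 (fun k => u k 0) hu0
  have hle1 : ∀ k : ℤ, 1 ≤ Real.exp (σ * |(k:ℝ)|) := fun k => Real.one_le_exp (by positivity)
  have huw : ∀ k, ∀ t ∈ Set.Icc (0:ℝ) 1, u k t = w k t := by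
    intro k t ht
    have := dls_unique (fun k t => u k t - w k t) ?_ ?_ ?_ k t ht
    · exact sub_eq_zero.1 this
    · intro t ht
      have hw2 : Summable fun k => ‖w k t‖ ^ 2 := by
        have h1 : Summable fun k => ‖w k t‖ :=
          Summable.of_nonneg_of_le (fun _ => norm_nonneg _)
            (fun k => le_mul_of_one_le_left (norm_nonneg _) (hle1 k)) (hws t)
        refine Summable.of_nonneg_of_le (fun _ => by positivity) (fun k => ?_)
          (h1.mul_left (∑' k, ‖w k t‖))
        rw [sq]
        exact mul_le_mul_of_nonneg_right (h1.le_tsum k (fun _ _ => norm_nonneg _)) (norm_nonneg _)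
      refine Summable.of_nonneg_of_le (fun _ => by positivity) (fun k => ?_)
        (((hl2 t ht).mul_left 2).add (hw2.mul_left 2))
      have := norm_sub_le (u k t) (w k t)
      nlinarith [sq_nonneg (‖u k t‖ - ‖w k t‖), norm_nonneg (u k t - w k t)]
    · intro k t ht
      refine ((hode k t ht).fun_sub (hwode k t)).congr_deriv ?_
      ring
    · intro k
      simp [hw0]
  have hus : ∀ t ∈ Set.Icc (0:ℝ) 1, Summable fun k : ℤ => Real.exp (σ * |(k:ℝ)|) * ‖u k t‖ := by
    intro t ht
    simpa only [huw _ t ht] using hws t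
  have hω : ∀ k : ℤ, Real.exp (2 * α * j * k) ≤ Real.exp (σ * |(k:ℝ)|) := by
    intro k
    apply Real.exp_le_exp.2
    refine (le_abs_self _).trans (le_of_eq ?_)
    rw [abs_mul, abs_mul, abs_of_pos (by positivity : 0 < 2 * α)]
  set K : ℝ := C * (Real.exp (α * (j:ℝ) ^ 2) * S) with hK
  have hcs : ∀ t ∈ Set.Icc (0:ℝ) 1, Summable fun k : ℤ => Real.exp (2 * α * j * k) * ‖u k t‖ :=
    fun t ht => Summable.of_nonneg_of_le (fun k => by positivity)
      (fun k => mul_le_mul_of_nonneg_right (hω k) (norm_nonneg _)) (hus t ht)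
  have main := coeff_bound (fun k => (Real.exp (2 * α * j * k) : ℂ) * u k t) ?_ K ?_ j
  · rw [norm_mul, Complex.norm_real, Real.norm_of_nonneg (Real.exp_pos _).le] at main
    have e1 : Real.exp (2 * α * j * j) = Real.exp (α * (j:ℝ)^2) * Real.exp (α * (j:ℝ)^2) := by
      rw [← Real.exp_add]; congr 1; ring
    rw [e1, hK] at main
    have hp := Real.exp_pos (α * (j:ℝ)^2)
    have h3 : Real.exp (α * (j:ℝ)^2) * ‖u j t‖ ≤ C * S := by
      refine le_of_mul_le_mul_left ?_ hp
      linarith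
    rw [neg_mul, Real.exp_neg, ← div_eq_mul_inv, le_div_iff₀ hp]
    linarith
  · refine (hcs t ht).congr fun k => ?_
    rw [norm_mul, Complex.norm_real, Real.norm_of_nonneg (Real.exp_pos _).le]
  · intro x
    set z : ℂ := Complex.exp ((2 * α * j : ℝ) + x * Complex.I) with hz
    have hzk : ∀ k : ℤ, z ^ k = (Real.exp (2 * α * j * k) : ℂ) * Complex.exp (k * (x * Complex.I)) := by
      intro k
      rw [hz, ← Complex.exp_int_mul, Complex.ofReal_exp, ← Complex.exp_add]
      congr 1; push_cast; ring
    have hzn : ∀ k : ℤ, ‖z ^ k‖ = Real.exp (2 * α * j * k) := by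
      intro k
      rw [hz, ← Complex.exp_int_mul, Complex.norm_exp]
      congr 1
      simp [mul_comm]
    have hg : ∀ t ∈ Set.Icc (0:ℝ) 1, ∑' k : ℤ, z ^ k * u k t =
        Complex.exp (t * (Complex.I * (z + z⁻¹ - 2))) * ∑' k : ℤ, z ^ k * u k 0 := by
      intro t ht
      rw [← hwz z (Complex.exp_ne_zero _) (fun k => by rw [hzn]; exact hω k) t]
      simp only [huw _ t ht]
    have hend : ∀ t ∈ Set.Icc (0:ℝ) 1, (∀ k, ‖u k t‖ ≤ C * Real.exp (-α * (k:ℝ) ^ 2)) →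
        ‖∑' k : ℤ, z ^ k * u k t‖ ≤ K := by
      intro t ht hb
      refine tsum_of_norm_bounded (hshift j) fun k => ?_
      rw [norm_mul, hzn]
      exact mul_le_mul_of_nonneg_left (hb k) (Real.exp_pos _).le
    have hb0 := hend 0 (by simp) (fun k => by linarith [hdecay k, norm_nonneg (u k 1)])
    have hb1 := hend 1 (by simp) (fun k => by linarith [hdecay k, norm_nonneg (u k 0)])
    have e1 : ∑' k : ℤ, (Real.exp (2 * α * j * k) : ℂ) * u k t * Complex.exp (k * (x * Complex.I))
        = ∑' k : ℤ, z ^ k * u k t := by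
      congr 1; ext k; rw [hzk]; ring
    rw [e1, hg t ht, norm_mul, Complex.norm_exp, Complex.re_ofReal_mul]
    rw [hg 1 (by simp), norm_mul, Complex.norm_exp, Complex.re_ofReal_mul, one_mul] at hb1
    set r := (Complex.I * (z + z⁻¹ - 2)).re
    rcases le_total r 0 with hr | hr
    · have : Real.exp (t * r) ≤ 1 := Real.exp_le_one_iff.2 (mul_nonpos_of_nonneg_of_nonpos ht.1 hr)
      exact (mul_le_of_le_one_left (norm_nonneg _) this).trans hb0
    · have : Real.exp (t * r) ≤ Real.exp r := Real.exp_le_exp.2 (by nlinarith [ht.2])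
      exact (mul_le_mul_of_nonneg_right this (norm_nonneg _)).trans hb1
end

section
/- Suppose u : ℤ^d × [0,1] → ℂ solves the free discrete Schrödinger equation ∂_t u_j = i Δ_d u_j and satisfies ∑_{j∈ℤ^d} e^{2λ|j|²} |u_j(0)|² + ∑_{j∈ℤ^d} e^{2λ|j|²} |u_j(1)|² < ∞ for some λ > 0. Then G(t) = ∑_{j∈ℤ^d} e^{2λ|j|²} |u_j(t)|² satisfies G(t) ≤ G(0)^{1−t} G(1)^t for all t ∈ [0,1]. -/
open Real Complex

/-- The `k`-th standard unit vector in `ℤ^d`. -/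
def unitVec (d : ℕ) (k : Fin d) : Fin d → ℤ := fun i => if i = k then 1 else 0

/-- Discrete Laplacian on `ℤ^d`. -/
noncomputable def discreteLap {d : ℕ} (u : (Fin d → ℤ) → ℂ) (j : Fin d → ℤ) : ℂ :=
  ∑ k : Fin d, (u (j + unitVec d k) - 2 * u j + u (j - unitVec d k))

/-- Square-summable complex sequences on the lattice. -/
noncomputable abbrev LatH (ι : Type*) := lp (fun _ : ι => ℂ) 2

theorem latH_sum_sq_le {ι : Type*} (f : LatH ι) (s : Finset ι) :
    ∑ i ∈ s, ‖f i‖ ^ 2 ≤ ‖f‖ ^ 2 := by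
  have := lp.sum_rpow_le_norm_rpow (p := 2) (by simp) f s
  simpa using this

theorem latH_norm_le {ι : Type*} {C : ℝ} (hC : 0 ≤ C) {f : LatH ι}
    (hf : ∀ s : Finset ι, ∑ i ∈ s, ‖f i‖ ^ 2 ≤ C ^ 2) : ‖f‖ ≤ C := by
  refine lp.norm_le_of_forall_sum_le (p := 2) (by simp) hC (fun s => ?_)
  simpa using hf s

theorem latH_norm_sq {ι : Type*} (f : LatH ι) : ‖f‖ ^ 2 = ∑' i, ‖f i‖ ^ 2 := by
  simpa using lp.norm_rpow_eq_tsum (p := 2) (by simp) f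

theorem latH_summable {ι : Type*} (f : LatH ι) : Summable fun i => ‖f i‖ ^ 2 := by
  simpa using (lp.memℓp f).summable (p := 2) (by simp)

theorem latH_memlp {ι : Type*} {f : ι → ℂ} (h : Summable fun i => ‖f i‖ ^ 2) :
    Memℓp f 2 := by
  refine memℓp_gen ?_
  simpa using h

/-- Mean value inequality for curves differentiable coordinatewise. -/
theorem latH_mean_value {ι : Type*} (w w' : ℝ → LatH ι) (s : Set ℝ) (hs : Convex ℝ s) (C : ℝ)
    (hd : ∀ j, ∀ t ∈ s, HasDerivWithinAt (fun r => w r j) (w' t j) s t)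
    (hb : ∀ t ∈ s, ‖w' t‖ ≤ C) (p q : ℝ) (hp : p ∈ s) (hq : q ∈ s) :
    ‖w q - w p‖ ≤ C * ‖q - p‖ := by
  have hC : 0 ≤ C := (norm_nonneg _).trans (hb p hp)
  refine latH_norm_le (by positivity) (fun F => ?_)
  let P : LatH ι → EuclideanSpace ℂ F := fun f => WithLp.toLp 2 (fun i => f i)
  have hPn : ∀ f : LatH ι, ‖P f‖ ^ 2 = ∑ i ∈ F, ‖f i‖ ^ 2 := by
    intro f
    rw [EuclideanSpace.norm_sq_eq]
    simp only [P]
    exact Finset.sum_coe_sort F (fun i => ‖f i‖ ^ 2)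
  have hder : ∀ t ∈ s, HasDerivWithinAt (fun r => P (w r)) (P (w' t)) s t := by
    intro t ht
    rw [hasDerivWithinAt_iff_hasFDerivWithinAt, hasFDerivWithinAt_piLp]
    intro i
    have := (hd i t ht).hasFDerivWithinAt
    refine HasFDerivWithinAt.congr_fderiv this ?_
    ext
    simp [P]
  have hbd : ∀ t ∈ s, ‖P (w' t)‖ ≤ C := by
    intro t ht
    have h1 : ‖P (w' t)‖ ^ 2 ≤ ‖w' t‖ ^ 2 := by
      rw [hPn]; exact latH_sum_sq_le _ _
    exact (abs_le_of_sq_le_sq' h1 (norm_nonneg _)).2.trans (hb t ht)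
  have key := hs.norm_image_sub_le_of_norm_hasDerivWithin_le hder hbd hp hq
  have h2 : P (w q) - P (w p) = P (w q - w p) := by
    ext i; simp [P]
  rw [h2] at key
  rw [← hPn]
  gcongr

theorem latH_strong_deriv {ι : Type*} (B : LatH ι →L[ℂ] LatH ι) (w : ℝ → LatH ι)
    (s : Set ℝ) (hs : Convex ℝ s) (M : ℝ)
    (hd : ∀ j, ∀ t ∈ s, HasDerivWithinAt (fun r => w r j) (B (w t) j) s t)
    (hb : ∀ t ∈ s, ‖w t‖ ≤ M) :
    ∀ t ∈ s, HasDerivWithinAt w (B (w t)) s t := by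
  intro t ht
  have hM : 0 ≤ M := (norm_nonneg _).trans (hb t ht)
  have hL : ∀ p ∈ s, ∀ q ∈ s, ‖w q - w p‖ ≤ (‖B‖ * M) * ‖q - p‖ := by
    intro p hp q hq
    refine latH_mean_value w (fun r => B (w r)) s hs _ hd (fun r hr => ?_) p q hp hq
    exact (B.le_opNorm _).trans (by gcongr; exact hb r hr)
  have hQ : ∀ q ∈ s, ‖w q - w t - (q - t) • B (w t)‖ ≤ (‖B‖ * (‖B‖ * M)) * ‖q - t‖ ^ 2 := by
    intro q hq
    let s' := s ∩ Set.uIcc t q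
    have hs' : Convex ℝ s' := hs.inter (convex_uIcc _ _)
    have := latH_mean_value (fun r => w r - (r - t) • B (w t)) (fun r => B (w r) - B (w t)) s' hs'
      ((‖B‖ * (‖B‖ * M)) * ‖q - t‖) ?_ ?_ t q ⟨ht, by simp⟩ ⟨hq, by simp⟩
    · simp only [sub_self, zero_smul, sub_zero] at this
      calc _ = ‖w q - (q - t) • B (w t) - w t‖ := by congr 1; abel
        _ ≤ _ := this
        _ = _ := by ring
    · intro j r hr
      have h1 := (hd j r hr.1).mono (Set.inter_subset_left : s' ⊆ s)
      have h2 : HasDerivWithinAt (fun r : ℝ => ((r - t : ℝ) : ℂ) * (B (w t) j)) (1 * (B (w t) j)) s' r := by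
        have h3 : HasDerivAt (fun r : ℝ => ((r - t : ℝ) : ℂ)) 1 r := by
          simpa using ((hasDerivAt_id r).sub_const t).ofReal_comp
        exact (h3.mul_const _).hasDerivWithinAt
      have h4 := h1.sub h2
      rw [one_mul] at h4
      refine h4.congr_of_eventuallyEq (Filter.Eventually.of_forall fun x => ?_) ?_
      · change w x j - (x - t) • (B (w t) j) = w x j - ((x - t : ℝ) : ℂ) * (B (w t) j)
        rw [Complex.real_smul]
      · change w r j - (r - t) • (B (w t) j) = w r j - ((r - t : ℝ) : ℂ) * (B (w t) j)
        rw [Complex.real_smul]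
    · intro r hr
      rw [← map_sub]
      have h5 : ‖r - t‖ ≤ ‖q - t‖ := by
        simpa [Real.norm_eq_abs] using Set.abs_sub_left_of_mem_uIcc hr.2
      calc _ ≤ ‖B‖ * ‖w r - w t‖ := B.le_opNorm _
        _ ≤ ‖B‖ * ((‖B‖ * M) * ‖q - t‖) := by
          gcongr
          exact (hL t ht r hr.1).trans (by gcongr)
        _ = _ := by ring
  rw [hasDerivWithinAt_iff_isLittleO]
  have hO : (fun q => w q - w t - (q - t) • B (w t)) =O[nhdsWithin t s] fun q => ‖q - t‖ ^ 2 := by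
    refine Asymptotics.IsBigO.of_bound (‖B‖ * (‖B‖ * M)) ?_
    filter_upwards [self_mem_nhdsWithin] with q hq
    simpa using hQ q hq
  refine hO.trans_isLittleO ?_
  have : (fun q : ℝ => ‖q - t‖ ^ 2) =o[nhds t] fun q => q - t := by
    have := Asymptotics.isLittleO_pow_sub_sub t (m := 2) (by norm_num)
    simpa using this
  exact this.mono nhdsWithin_le_nhds

theorem exp_smul_norm_le {E : Type*} [NormedAddCommGroup E] [NormedSpace ℂ E] [CompleteSpace E]
    (B : E →L[ℂ] E) : ∃ K : ℝ, 0 < K ∧ ∀ (t : ℝ), |t| ≤ 1 → ∀ x : E,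
    ‖NormedSpace.exp (t • B) x‖ ≤ K * ‖x‖ := by
  have hc : Continuous (fun t : ℝ => NormedSpace.exp (t • B)) :=
    (differentiable_exp_smul_const ℝ B).continuous
  obtain ⟨K, hK⟩ := (isCompact_Icc (a := (-1 : ℝ)) (b := 1)).exists_bound_of_continuousOn
    hc.continuousOn
  refine ⟨max K 1, by positivity, fun t ht x => ?_⟩
  refine (ContinuousLinearMap.le_opNorm _ _).trans ?_
  gcongr
  exact (hK t (abs_le.1 ht)).trans (le_max_left _ _)

theorem latH_unique_of_bdd {ι : Type*} (B : LatH ι →L[ℂ] LatH ι) (w : ℝ → LatH ι)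
    (s : Set ℝ) (hs : Convex ℝ s) (M : ℝ)
    (hd : ∀ j, ∀ t ∈ s, HasDerivWithinAt (fun r => w r j) (B (w t) j) s t)
    (hb : ∀ t ∈ s, ‖w t‖ ≤ M) (p q : ℝ) (hp : p ∈ s) (hq : q ∈ s) :
    NormedSpace.exp ((-q) • B) (w q) = NormedSpace.exp ((-p) • B) (w p) := by
  have hst := latH_strong_deriv B w s hs M hd hb
  have hder : ∀ t ∈ s, HasDerivWithinAt (fun r : ℝ => NormedSpace.exp ((-r) • B) (w r)) 0 s t := by
    intro t ht
    have h1 : HasDerivAt (fun r : ℝ => NormedSpace.exp (r • (-B)))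
        (NormedSpace.exp (t • (-B)) * (-B)) t := hasDerivAt_exp_smul_const (-B) t
    have h2 : HasDerivWithinAt (fun r : ℝ => (NormedSpace.exp (r • (-B))).restrictScalars ℝ)
        ((NormedSpace.exp (t • (-B)) * (-B)).restrictScalars ℝ) s t := 
      ((ContinuousLinearMap.restrictScalarsL ℂ (LatH ι) (LatH ι) ℝ ℝ).hasFDerivAt.comp_hasDerivAt t h1).hasDerivWithinAt
    have h3 := h2.clm_apply (hst t ht)
    simpa using h3
  have := hs.norm_image_sub_le_of_norm_hasDerivWithin_le hder (C := 0) (by simp) hp hq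
  rw [zero_mul] at this
  exact sub_eq_zero.1 (norm_le_zero_iff.1 this)

theorem exp_neg_smul_apply {E : Type*} [NormedAddCommGroup E] [NormedSpace ℂ E] [CompleteSpace E]
    (B : E →L[ℂ] E) (t : ℝ) (x : E) :
    NormedSpace.exp (t • B) (NormedSpace.exp ((-t) • B) x) = x := by
  let +nondep : NormedAlgebra ℚ (E →L[ℂ] E) := NormedAlgebra.restrictScalars ℚ ℂ (E →L[ℂ] E)
  rw [← mul_apply_eq_comp, ← NormedSpace.exp_add_of_commute]
  · simp
  · exact ((Commute.refl B).smul_left _).smul_right _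

open Set Filter Topology in
theorem latH_unique {ι : Type*} (B : LatH ι →L[ℂ] LatH ι) (w : ℝ → LatH ι)
    (hd : ∀ j, ∀ t ∈ Icc (0:ℝ) 1, HasDerivWithinAt (fun r => w r j) (B (w t) j) (Icc 0 1) t) :
    ∀ t ∈ Icc (0:ℝ) 1, w t = NormedSpace.exp (t • B) (w 0) := by
  set z : ℝ → LatH ι := fun t => NormedSpace.exp ((-t) • B) (w t) with hz
  have hzw : ∀ t, w t = NormedSpace.exp (t • B) (z t) := fun t => (exp_neg_smul_apply B t _).symm
  obtain ⟨K, hK0, hK⟩ := exp_smul_norm_le B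
  have hwz : ∀ t ∈ Icc (0:ℝ) 1, ‖w t‖ ≤ K * ‖z t‖ := by
    intro t ht
    conv_lhs => rw [hzw t]
    exact hK t (abs_le.2 ⟨by linarith [ht.1], ht.2⟩) _
  have hzw' : ∀ t ∈ Icc (0:ℝ) 1, ‖z t‖ ≤ K * ‖w t‖ := by
    intro t ht
    exact hK (-t) (abs_le.2 ⟨by linarith [ht.2], by linarith [ht.1]⟩) _
  -- bounded on a convex set implies `z` constant there
  have hconst : ∀ s : Set ℝ, Convex ℝ s → s ⊆ Icc 0 1 → ∀ M : ℝ, (∀ t ∈ s, ‖w t‖ ≤ M) →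
      ∀ p ∈ s, ∀ q ∈ s, z q = z p := by
    intro s hs hs1 M hM p hp q hq
    exact latH_unique_of_bdd B w s hs M (fun j t ht => (hd j t (hs1 ht)).mono hs1) hM p q hp hq
  let U : Set ℝ := {t | ∃ M : ℝ, ∀ᶠ s in 𝓝 t, s ∈ Icc (0:ℝ) 1 → ‖w s‖ ≤ M}
  have hU : IsOpen U := by
    rw [isOpen_iff_mem_nhds]
    rintro t ⟨M, hM⟩
    filter_upwards [eventually_eventually_nhds.2 hM] with s hs using ⟨M, hs⟩
  -- compactness
  have hcomp : ∀ a b : ℝ, Icc a b ⊆ Icc 0 1 → Icc a b ⊆ U →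
      ∃ M : ℝ, ∀ t ∈ Icc a b, ‖w t‖ ≤ M := by
    intro a b h01 hab
    refine (isCompact_Icc (a := a) (b := b)).induction_on
      (p := fun s => ∃ M : ℝ, ∀ t ∈ s, ‖w t‖ ≤ M) ⟨0, by simp⟩ ?_ ?_ ?_
    · rintro s t hst ⟨M, hM⟩
      exact ⟨M, fun x hx => hM x (hst hx)⟩
    · rintro s t ⟨M, hM⟩ ⟨N, hN⟩
      refine ⟨max M N, ?_⟩
      rintro x (hx | hx)
      · exact (hM x hx).trans (le_max_left _ _)
      · exact (hN x hx).trans (le_max_right _ _)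
    · intro x hx
      obtain ⟨M, hM⟩ := hab hx
      refine ⟨_, inter_mem_nhdsWithin _ hM, M, ?_⟩
      rintro t ⟨ht1, ht2⟩
      exact ht2 (h01 ht1)
  -- half-open intervals
  have hR : ∀ s a : ℝ, s < a → Icc s a ⊆ Icc 0 1 → Ico s a ⊆ U → z a = z s := by
    intro s a hsa h01 hsU
    have h1 : ∀ r ∈ Ico s a, z r = z s := by
      intro r hr
      have hsub : Icc s r ⊆ Ico s a := fun x hx => ⟨hx.1, hx.2.trans_lt hr.2⟩
      obtain ⟨M, hM⟩ := hcomp s r (hsub.trans (Ico_subset_Icc_self.trans h01)) (hsub.trans hsU)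
      exact hconst (Icc s r) (convex_Icc _ _) (hsub.trans (Ico_subset_Icc_self.trans h01)) M hM
        s ⟨le_rfl, hr.1⟩ r ⟨hr.1, le_rfl⟩
    refine hconst (Icc s a) (convex_Icc _ _) h01 (max (K * ‖z s‖) ‖w a‖) ?_ s
      ⟨le_rfl, hsa.le⟩ a ⟨hsa.le, le_rfl⟩
    intro t ht
    rcases eq_or_lt_of_le ht.2 with h | h
    · rw [h]; exact le_max_right _ _
    · refine le_trans ?_ (le_max_left _ _)
      rw [← h1 t ⟨ht.1, h⟩]
      exact hwz t (h01 ht)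
  have hL : ∀ a s : ℝ, a < s → Icc a s ⊆ Icc 0 1 → Ioc a s ⊆ U → z a = z s := by
    intro a s hsa h01 hsU
    have h1 : ∀ r ∈ Ioc a s, z r = z s := by
      intro r hr
      have hsub : Icc r s ⊆ Ioc a s := fun x hx => ⟨hr.1.trans_le hx.1, hx.2⟩
      obtain ⟨M, hM⟩ := hcomp r s (hsub.trans (Ioc_subset_Icc_self.trans h01)) (hsub.trans hsU)
      exact hconst (Icc r s) (convex_Icc _ _) (hsub.trans (Ioc_subset_Icc_self.trans h01)) M hM
        s ⟨hr.2, le_rfl⟩ r ⟨le_rfl, hr.2⟩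
    refine hconst (Icc a s) (convex_Icc _ _) h01 (max (K * ‖z s‖) ‖w a‖) ?_ s
      ⟨hsa.le, le_rfl⟩ a ⟨le_rfl, hsa.le⟩
    intro t ht
    rcases eq_or_lt_of_le ht.1 with h | h
    · rw [← h]; exact le_max_right _ _
    · refine le_trans ?_ (le_max_left _ _)
      rw [← h1 t ⟨h, ht.2⟩]
      exact hwz t (h01 ht)
  let E : Set ℝ := Icc 0 1 \ U
  have hEc : IsClosed E := isClosed_Icc.sdiff hU
  have hEempty : E = ∅ := by
    by_contra hne
    have hne' : Nonempty E := (nonempty_iff_ne_empty.2 hne).to_subtype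
    have hcs : CompleteSpace E := hEc.completeSpace_coe
    let f : ℕ → Set E := fun n => {t | ‖w t‖ ≤ n}
    have hfc : ∀ n, IsClosed (f n) := by
      intro n
      have : f n = ⋂ F : Finset ι, {t : E | ∑ j ∈ F, ‖w t j‖ ^ 2 ≤ (n:ℝ) ^ 2} := by
        ext t
        simp only [f, mem_ofPred_eq, mem_iInter]
        constructor
        · intro h F
          exact (latH_sum_sq_le _ _).trans (by gcongr)
        · intro h
          exact latH_norm_le (by positivity) h
      rw [this]
      refine isClosed_iInter fun F => isClosed_le ?_ continuous_const
      refine continuous_finsetSum _ fun j _ => ?_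
      have hc : ContinuousOn (fun r => w r j) (Icc 0 1) := fun t ht => (hd j t ht).continuousWithinAt
      have hc' : Continuous (fun t : E => w t j) :=
        (hc.mono sdiff_subset).comp_continuous continuous_subtype_val (fun t => t.2)
      exact hc'.norm.pow 2
    have hfU : ⋃ n, f n = univ := by
      refine eq_univ_of_forall fun t => ?_
      obtain ⟨n, hn⟩ := exists_nat_ge ‖w t‖
      exact mem_iUnion.2 ⟨n, hn⟩
    obtain ⟨n, ⟨t0, ht0⟩⟩ := nonempty_interior_of_iUnion_of_closed hfc hfU
    rw [mem_interior_iff_mem_nhds, Metric.mem_nhds_iff] at ht0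
    obtain ⟨δ, hδ, hball⟩ := ht0
    have hEb : ∀ t ∈ E, |t - t0| < δ → ‖w t‖ ≤ n := by
      intro t ht h
      exact hball (show (⟨t, ht⟩ : E) ∈ Metric.ball t0 δ from h)
    have ht01 : (t0 : ℝ) ∈ Icc (0:ℝ) 1 := t0.2.1
    apply t0.2.2
    refine ⟨max n (K * (K * n)), ?_⟩
    filter_upwards [Metric.ball_mem_nhds (t0 : ℝ) hδ] with s hs hs01
    rw [Metric.mem_ball, Real.dist_eq] at hs
    by_cases hsE : s ∈ E
    · exact (hEb s hsE hs).trans (le_max_left _ _)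
    refine le_trans ?_ (le_max_right _ _)
    suffices h : ∃ a ∈ E, |a - t0| < δ ∧ z a = z s by
      obtain ⟨a, haE, had, haz⟩ := h
      refine (hwz s hs01).trans ?_
      rw [← haz]
      gcongr
      refine (hzw' a haE.1).trans ?_
      gcongr
      exact hEb a haE had
    have hst : s ≠ t0 := fun h => hsE (h ▸ t0.2)
    rcases lt_or_gt_of_ne hst with hlt | hgt
    · have hSc : IsCompact (E ∩ Icc s t0) := isCompact_Icc.inter_left hEc
      obtain ⟨a, ⟨haE, ha⟩, hamin⟩ := hSc.exists_isLeast ⟨t0, t0.2, hlt.le, le_rfl⟩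
      have hsa : s < a := lt_of_le_of_ne ha.1 (fun h => hsE (h ▸ haE))
      refine ⟨a, haE, ?_, ?_⟩
      · rw [abs_lt] at hs ⊢
        constructor <;> linarith [ha.1, ha.2]
      · refine hR s a hsa (Icc_subset_Icc hs01.1 haE.1.2) ?_
        intro x hx
        by_contra hxU
        have := hamin ⟨⟨⟨hs01.1.trans hx.1, hx.2.le.trans haE.1.2⟩, hxU⟩, hx.1, hx.2.le.trans ha.2⟩
        exact absurd hx.2 (not_lt.2 this)
    · have hSc : IsCompact (E ∩ Icc t0 s) := isCompact_Icc.inter_left hEc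
      obtain ⟨a, ⟨haE, ha⟩, hamax⟩ := hSc.exists_isGreatest ⟨t0, t0.2, le_rfl, hgt.le⟩
      have hsa : a < s := lt_of_le_of_ne ha.2 (fun h => hsE (h ▸ haE))
      refine ⟨a, haE, ?_, ?_⟩
      · rw [abs_lt] at hs ⊢
        constructor <;> linarith [ha.1, ha.2]
      · refine hL a s hsa (Icc_subset_Icc haE.1.1 hs01.2) ?_
        intro x hx
        by_contra hxU
        have := hamax ⟨⟨⟨haE.1.1.trans hx.1.le, hx.2.trans hs01.2⟩, hxU⟩, ha.1.trans hx.1.le, hx.2⟩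
        exact absurd hx.1 (not_lt.2 this)
  have hIU : Icc (0:ℝ) 1 ⊆ U := by
    rw [← sdiff_eq_empty]; exact hEempty
  obtain ⟨M, hM⟩ := hcomp 0 1 subset_rfl hIU
  intro t ht
  have h := hconst (Icc 0 1) (convex_Icc _ _) subset_rfl M hM 0 ⟨le_rfl, zero_le_one⟩ t ht
  have h0 : z 0 = w 0 := by simp [hz]
  rw [hzw t, h, h0]

theorem norm_exp_I_smul_selfAdjoint {E : Type*} [NormedAddCommGroup E] [InnerProductSpace ℂ E]
    [CompleteSpace E] (C : E →L[ℂ] E) (hC : IsSelfAdjoint C) (x : E) :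
    ‖NormedSpace.exp (Complex.I • C) x‖ = ‖x‖ := by
  have h := (selfAdjoint.expUnitary ⟨C, hC⟩).2
  exact ContinuousLinearMap.norm_map_of_mem_unitary h x

theorem normal_exp_interp {E : Type*} [NormedAddCommGroup E] [InnerProductSpace ℂ E]
    [CompleteSpace E] (B : E →L[ℂ] E) (hB : IsStarNormal B) (x : E) (t : ℝ)
    (ht : t ∈ Set.Icc (0:ℝ) 1) :
    ‖NormedSpace.exp (t • B) x‖ ≤ ‖x‖ ^ (1 - t) * ‖NormedSpace.exp B x‖ ^ t := by
  let +nondep : NormedAlgebra ℚ (E →L[ℂ] E) := NormedAlgebra.restrictScalars ℚ ℂ (E →L[ℂ] E)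
  obtain ⟨S, hS⟩ : ∃ S : E →L[ℂ] E, S = (realPart B : E →L[ℂ] E) := ⟨_, rfl⟩
  obtain ⟨A, hA⟩ : ∃ A : E →L[ℂ] E, A = (imaginaryPart B : E →L[ℂ] E) := ⟨_, rfl⟩
  have hSs : IsSelfAdjoint S := hS ▸ (realPart B).2
  have hAs : IsSelfAdjoint A := hA ▸ (imaginaryPart B).2
  have hSA : Commute S A := by
    rw [hS, hA]; exact isStarNormal_iff_commute_realPart_imaginaryPart.1 hB
  have hBd : B = S + Complex.I • A := by
    rw [hS, hA]; exact (realPart_add_I_smul_imaginaryPart B).symm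
  have hsm : ∀ (r : ℝ) (C : E →L[ℂ] E), IsSelfAdjoint C → IsSelfAdjoint ((r : ℂ) • C) := by
    intro r C hC
    rw [isSelfAdjoint_iff, star_smul, hC.star_eq]
    simp
  have hBt : ∀ r : ℝ, ‖NormedSpace.exp (r • B) x‖ = ‖NormedSpace.exp ((r : ℂ) • S) x‖ := by
    intro r
    have h1 : r • B = Complex.I • ((r : ℂ) • A) + (r : ℂ) • S := by
      rw [← Complex.coe_smul r B, hBd, smul_add, smul_comm Complex.I (r : ℂ) A, add_comm]
    rw [h1, NormedSpace.exp_add_of_commute, mul_apply_eq_comp,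
      norm_exp_I_smul_selfAdjoint _ (hsm r A hAs)]
    exact (((hSA.symm).smul_left _).smul_left Complex.I).smul_right _
  have hFz : ∀ z : ℂ, ‖NormedSpace.exp (z • S) x‖ = ‖NormedSpace.exp ((z.re : ℂ) • S) x‖ := by
    intro z
    have h1 : z • S = Complex.I • ((z.im : ℂ) • S) + (z.re : ℂ) • S := by
      conv_lhs => rw [← Complex.re_add_im z]
      rw [add_smul, mul_comm, mul_smul, add_comm]
    rw [h1, NormedSpace.exp_add_of_commute, mul_apply_eq_comp,
      norm_exp_I_smul_selfAdjoint _ (hsm _ S hSs)]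
    exact (((Commute.refl S).smul_left _).smul_left Complex.I).smul_right _
  obtain ⟨K, hK0, hK⟩ := exp_smul_norm_le S
  have hdiff : Differentiable ℂ (fun z : ℂ => NormedSpace.exp (z • S) x) := by
    intro z
    exact (differentiable_exp_smul_const ℂ S z).clm_apply (differentiableAt_const x)
  have h := Complex.HadamardThreeLines.norm_le_interp_of_mem_verticalClosedStrip₀₁'
    (fun z : ℂ => NormedSpace.exp (z • S) x) (z := (t : ℂ)) (a := ‖x‖) (b := ‖NormedSpace.exp B x‖)
    (by simpa [Complex.HadamardThreeLines.verticalClosedStrip] using ht) hdiff.diffContOnCl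
    ?_ ?_ ?_
  · rw [hBt]
    simpa using h
  · refine ⟨K * ‖x‖, ?_⟩
    rintro _ ⟨z, hz, rfl⟩
    have hz' : z.re ∈ Set.Icc (0:ℝ) 1 := hz
    simp only [Function.comp]
    rw [hFz]
    have := hK z.re (abs_le.2 ⟨by linarith [hz'.1], hz'.2⟩) x
    simpa using this
  · intro z hz
    have hz' : z.re = 0 := hz
    rw [hFz, hz']
    simp
  · intro z hz
    have hz' : z.re = 1 := hz
    rw [hFz, hz', ← hBt, one_smul]

/-- Translation of a sequence. -/
noncomputable def latShiftFun {G : Type*} [AddCommGroup G] (a : G) (f : LatH G) : LatH G :=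
  ⟨fun j => f (j + a), latH_memlp ((latH_summable f).comp_injective (add_left_injective a))⟩

theorem latShiftFun_norm {G : Type*} [AddCommGroup G] (a : G) (f : LatH G) :
    ‖latShiftFun a f‖ = ‖f‖ := by
  have h : ‖latShiftFun a f‖ ^ 2 = ‖f‖ ^ 2 := by
    rw [latH_norm_sq, latH_norm_sq]
    exact (Equiv.addRight a).tsum_eq (fun j => ‖f j‖ ^ 2)
  exact (sq_eq_sq₀ (norm_nonneg _) (norm_nonneg _)).1 h

/-- Translation as a linear map. -/
noncomputable def latShiftLin {G : Type*} [AddCommGroup G] (a : G) : LatH G →ₗ[ℂ] LatH G where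
  toFun := latShiftFun a
  map_add' f g := by ext j; rfl
  map_smul' c f := by ext j; rfl

/-- Translation operator. -/
noncomputable def latShift {G : Type*} [AddCommGroup G] (a : G) : LatH G →L[ℂ] LatH G :=
  LinearMap.mkContinuous (latShiftLin a) 1
    (fun f => by rw [one_mul]; exact (latShiftFun_norm a f).le)

theorem latShift_apply {G : Type*} [AddCommGroup G] (a : G) (f : LatH G) (j : G) :
    latShift a f j = f (j + a) := rfl

theorem latShift_commute {G : Type*} [AddCommGroup G] (a b : G) :
    Commute (latShift a) (latShift b) := by
  refine ContinuousLinearMap.ext fun f => ?_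
  ext j
  change f (j + a + b) = f (j + b + a)
  rw [add_right_comm]

theorem latShift_star {G : Type*} [AddCommGroup G] (a : G) :
    star (latShift a) = latShift (-a) := by
  rw [ContinuousLinearMap.star_eq_adjoint]
  symm
  rw [ContinuousLinearMap.eq_adjoint_iff]
  intro f g
  rw [lp.inner_eq_tsum, lp.inner_eq_tsum]
  rw [← (Equiv.addRight a).tsum_eq]
  refine tsum_congr fun j => ?_
  simp [latShift_apply]

/-- Generator of the conjugated evolution. -/
noncomputable def latB (d : ℕ) (y : Fin d → ℝ) :
    LatH (Fin d → ℤ) →L[ℂ] LatH (Fin d → ℤ) :=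
  Complex.I • ∑ k : Fin d, (((Real.exp (-y k) : ℝ) : ℂ) • latShift (unitVec d k)
    - (2 : ℂ) • (1 : LatH (Fin d → ℤ) →L[ℂ] LatH (Fin d → ℤ))
    + ((Real.exp (y k) : ℝ) : ℂ) • latShift (-unitVec d k))

theorem latB_commute_shift (d : ℕ) (y : Fin d → ℝ) (a : Fin d → ℤ) :
    Commute (latB d y) (latShift a) := by
  refine Commute.smul_left (Commute.sum_left _ _ _ fun k _ => ?_) _
  refine Commute.add_left (Commute.sub_left ?_ ?_) ?_
  · exact (latShift_commute _ _).smul_left _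
  · exact (Commute.one_left _).smul_left _
  · exact (latShift_commute _ _).smul_left _

theorem latB_normal (d : ℕ) (y : Fin d → ℝ) : IsStarNormal (latB d y) := by
  constructor
  have h : star (latB d y) = star Complex.I • ∑ k : Fin d,
      (((Real.exp (-y k) : ℝ) : ℂ) • latShift (-unitVec d k)
    - (2 : ℂ) • (1 : LatH (Fin d → ℤ) →L[ℂ] LatH (Fin d → ℤ))
    + ((Real.exp (y k) : ℝ) : ℂ) • latShift (unitVec d k)) := by
    rw [latB, star_smul, star_sum]
    congr 1
    refine Finset.sum_congr rfl fun k _ => ?_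
    rw [star_add, star_sub, star_smul, star_smul, star_smul, latShift_star, latShift_star, star_one,
      neg_neg, Complex.star_def, Complex.conj_ofReal, Complex.conj_ofReal, Complex.conj_ofNat]
  rw [h]
  refine (Commute.smul_right (Commute.sum_right _ _ _ fun k _ => ?_) _).symm
  refine Commute.add_right (Commute.sub_right ?_ ?_) ?_
  · exact (latB_commute_shift _ _ _).smul_right _
  · exact (Commute.one_right _).smul_right _
  · exact (latB_commute_shift _ _ _).smul_right _

theorem latB_apply (d : ℕ) (y : Fin d → ℝ) (f : LatH (Fin d → ℤ)) (j : Fin d → ℤ) :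
    latB d y f j = Complex.I * ∑ k : Fin d, (((Real.exp (-y k) : ℝ) : ℂ) * f (j + unitVec d k)
      - 2 * f j + ((Real.exp (y k) : ℝ) : ℂ) * f (j - unitVec d k)) := by
  have h : ∀ f : LatH (Fin d → ℤ), f j = lp.evalCLM (𝕜 := ℂ) (fun _ : (Fin d → ℤ) => ℂ) 2 j f :=
    fun f => rfl
  rw [latB, _root_.smul_apply, _root_.sum_apply]
  rw [h, map_smul, map_sum, smul_eq_mul]
  congr 1

theorem latB_zero_apply (d : ℕ) (f : LatH (Fin d → ℤ)) (j : Fin d → ℤ) :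
    latB d 0 f j = Complex.I * discreteLap (fun m => f m) j := by
  rw [latB_apply, discreteLap]
  simp

/-- The exponential weight. -/
noncomputable def latW (d : ℕ) (y : Fin d → ℝ) (j : Fin d → ℤ) : ℝ :=
  Real.exp (∑ k, (j k : ℝ) * y k)

theorem latW_add (d : ℕ) (y : Fin d → ℝ) (j : Fin d → ℤ) (k : Fin d) :
    Real.exp (-y k) * latW d y (j + unitVec d k) = latW d y j := by
  rw [latW, latW, ← Real.exp_add]
  congr 1
  simp [unitVec, add_mul, Finset.sum_add_distrib]

theorem latW_sub (d : ℕ) (y : Fin d → ℝ) (j : Fin d → ℤ) (k : Fin d) :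
    Real.exp (y k) * latW d y (j - unitVec d k) = latW d y j := by
  rw [latW, latW, ← Real.exp_add]
  congr 1
  simp [unitVec, sub_mul, Finset.sum_sub_distrib]

theorem latB_conj (d : ℕ) (y : Fin d → ℝ) (f g : LatH (Fin d → ℤ))
    (h : ∀ j, g j = (latW d y j : ℂ) * f j) (j : Fin d → ℤ) :
    latB d y g j = (latW d y j : ℂ) * latB d 0 f j := by
  rw [latB_apply, latB_apply, mul_left_comm (latW d y j : ℂ) Complex.I, Finset.mul_sum _ _ (latW d y j : ℂ)]
  refine congrArg (fun x => Complex.I * x) (Finset.sum_congr rfl fun k _ => ?_)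
  rw [h, h, h]
  have h1 : ((Real.exp (-y k) : ℝ) : ℂ) * (latW d y (j + unitVec d k) : ℂ) = latW d y j := by
    exact_mod_cast latW_add d y j k
  have h2 : ((Real.exp (y k) : ℝ) : ℂ) * (latW d y (j - unitVec d k) : ℂ) = latW d y j := by
    exact_mod_cast latW_sub d y j k
  have e0 : ((Real.exp (-(0 : Fin d → ℝ) k) : ℝ) : ℂ) = 1 := by simp
  have e1 : ((Real.exp ((0 : Fin d → ℝ) k) : ℝ) : ℂ) = 1 := by simp
  rw [e0, e1]
  linear_combination (f (j + unitVec d k)) * h1 + (f (j - unitVec d k)) * h2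

theorem latB_exp_conj (d : ℕ) (y : Fin d → ℝ) (f g : LatH (Fin d → ℤ))
    (h : ∀ j, g j = (latW d y j : ℂ) * f j) (t : ℝ) (j : Fin d → ℤ) :
    NormedSpace.exp (t • latB d y) g j
      = (latW d y j : ℂ) * NormedSpace.exp (t • latB d 0) f j := by
  have hn : ∀ n : ℕ, ∀ j, ((latB d y) ^ n) g j = (latW d y j : ℂ) * ((latB d 0) ^ n) f j := by
    intro n
    induction n with
    | zero => simpa using h
    | succ n ih =>
      intro j
      rw [pow_succ', pow_succ', mul_apply_eq_comp, mul_apply_eq_comp]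
      exact latB_conj d y _ _ ih j
  have hs : ∀ (y : Fin d → ℝ) (g : LatH (Fin d → ℤ)),
      HasSum (fun n : ℕ => ((n.factorial : ℂ)⁻¹ * (t : ℂ) ^ n) * ((latB d y) ^ n) g j)
        (NormedSpace.exp (t • latB d y) g j) := by
    intro y g
    have h1 := NormedSpace.exp_series_hasSum_exp' (𝕂 := ℂ) ((t : ℂ) • latB d y)
    have h2 := (h1.mapL (ContinuousLinearMap.apply ℂ (LatH (Fin d → ℤ)) g)).mapL
      (lp.evalCLM (𝕜 := ℂ) (fun _ : (Fin d → ℤ) => ℂ) 2 j)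
    have e : (t : ℂ) • latB d y = t • latB d y := Complex.coe_smul t _
    rw [e] at h2
    convert! h2 using 2 with n
    rw [← e, smul_pow, smul_smul]
    rfl
  have h1 := hs y g
  have h2 := (hs 0 f).mul_left (latW d y j : ℂ)
  refine h1.unique ?_
  convert! h2 using 2 with n
  rw [hn]
  ring

open MeasureTheory ProbabilityTheory in
theorem latW_gauss (d : ℕ) (lam : NNReal) (j : Fin d → ℤ) :
    ∫⁻ y, ENNReal.ofReal (latW d y j ^ 2) ∂(Measure.pi fun _ : Fin d => gaussianReal 0 lam)
      = ENNReal.ofReal (Real.exp (2 * lam * ∑ k, ((j k : ℝ) ^ 2))) := by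
  have e : ∀ y : Fin d → ℝ, latW d y j ^ 2 = ∏ k, Real.exp ((2 * (j k : ℝ)) * y k) := by
    intro y
    rw [latW, ← Real.exp_nat_mul, ← Real.exp_sum, Finset.mul_sum]
    congr 1
    refine Finset.sum_congr rfl fun k _ => ?_
    push_cast
    ring
  simp_rw [e]
  rw [← ofReal_integral_eq_lintegral_ofReal]
  · congr 1
    rw [integral_fintype_prod_eq_prod (f := fun k (x : ℝ) => Real.exp ((2 * (j k : ℝ)) * x))]
    have hm : ∀ c : ℝ, ∫ x, Real.exp (c * x) ∂(gaussianReal 0 lam)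
        = Real.exp (lam * c ^ 2 / 2) := by
      intro c
      have := congrFun (mgf_fun_id_gaussianReal (μ := 0) (v := lam)) c
      simpa [mgf] using this
    simp_rw [hm]
    rw [← Real.exp_sum, Finset.mul_sum]
    congr 1
    refine Finset.sum_congr rfl fun k _ => ?_
    ring
  · exact Integrable.fintype_prod (f := fun k (x : ℝ) => Real.exp ((2 * (j k : ℝ)) * x))
      (fun k => integrable_exp_mul_gaussianReal _)
  · exact Filter.Eventually.of_forall fun y => by positivity

theorem latW_sq_le (d : ℕ) (lam : ℝ) (hlam : 0 < lam) (y : Fin d → ℝ) (j : Fin d → ℤ) :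
    latW d y j ^ 2 ≤ Real.exp (∑ k, y k ^ 2 / (2 * lam)) *
      Real.exp (2 * lam * ∑ k, ((j k : ℝ) ^ 2)) := by
  rw [latW, ← Real.exp_nat_mul, ← Real.exp_add]
  gcongr
  rw [Finset.mul_sum, Finset.mul_sum, ← Finset.sum_add_distrib]
  refine Finset.sum_le_sum fun k _ => ?_
  have h : y k ^ 2 / (2 * lam) + 2 * lam * (j k : ℝ) ^ 2 - 2 * ((j k : ℝ) * y k)
      = (y k - 2 * lam * j k) ^ 2 / (2 * lam) := by
    field_simp
    ring
  have h2 : 0 ≤ (y k - 2 * lam * j k) ^ 2 / (2 * lam) := by positivity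
  push_cast
  linarith

theorem latH_ofReal_norm_sq {ι : Type*} (f : LatH ι) :
    ENNReal.ofReal (‖f‖ ^ 2) = ∑' i, ENNReal.ofReal (‖f i‖ ^ 2) := by
  rw [latH_norm_sq, ENNReal.ofReal_tsum_of_nonneg (fun i => by positivity) (latH_summable f)]

open MeasureTheory ProbabilityTheory in
theorem logConvexity_gaussian_weight (d : ℕ) (lam : ℝ) (hlam : 0 < lam)
    (u : (Fin d → ℤ) → ℝ → ℂ)
    (hl2 : ∀ t ∈ Set.Icc (0:ℝ) 1, Summable fun j => ‖u j t‖ ^ 2)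
    (hode : ∀ (j : Fin d → ℤ), ∀ t ∈ Set.Icc (0:ℝ) 1,
      HasDerivAt (u j) (Complex.I * discreteLap (fun m => u m t) j) t)
    (hdecay : Summable fun j : Fin d → ℤ =>
      Real.exp (2 * lam * ∑ k, ((j k : ℝ) ^ 2)) * (‖u j 0‖ ^ 2 + ‖u j 1‖ ^ 2)) :
    ∀ t ∈ Set.Icc (0:ℝ) 1,
      ∑' j : Fin d → ℤ, Real.exp (2 * lam * ∑ k, ((j k : ℝ) ^ 2)) * ‖u j t‖ ^ 2 ≤
        (∑' j : Fin d → ℤ, Real.exp (2 * lam * ∑ k, ((j k : ℝ) ^ 2)) * ‖u j 0‖ ^ 2) ^ (1 - t) *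
        (∑' j : Fin d → ℤ, Real.exp (2 * lam * ∑ k, ((j k : ℝ) ^ 2)) * ‖u j 1‖ ^ 2) ^ t := by
  intro t ht
  have h0m : (0:ℝ) ∈ Set.Icc (0:ℝ) 1 := ⟨le_rfl, zero_le_one⟩
  have h1m : (1:ℝ) ∈ Set.Icc (0:ℝ) 1 := ⟨zero_le_one, le_rfl⟩
  -- lift to `ℓ²`
  have hex : ∃ w : ℝ → LatH (Fin d → ℤ), ∀ s ∈ Set.Icc (0:ℝ) 1, ∀ j, w s j = u j s := by
    classical
    refine ⟨fun s => if h : s ∈ Set.Icc (0:ℝ) 1 then ⟨fun j => u j s, latH_memlp (hl2 s h)⟩ else 0, ?_⟩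
    intro s hs j
    simp only [dif_pos hs]
  obtain ⟨w, hw⟩ := hex
  have hsol := latH_unique (latB d 0) w (by
    intro j s hs
    have h1 := (hode j s hs).hasDerivWithinAt (s := Set.Icc 0 1)
    have h2 : latB d 0 (w s) j = Complex.I * discreteLap (fun m => u m s) j := by
      rw [latB_zero_apply]
      congr 2
      funext m
      exact hw s hs m
    rw [h2]
    exact h1.congr (fun r hr => hw r hr j) (hw s hs j))
  have hs0 : Summable fun j : Fin d → ℤ =>
      Real.exp (2 * lam * ∑ k, ((j k : ℝ) ^ 2)) * ‖u j 0‖ ^ 2 := by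
    refine Summable.of_nonneg_of_le (fun j => by positivity) (fun j => ?_) hdecay
    gcongr
    linarith [sq_nonneg ‖u j 1‖]
  have hs1 : Summable fun j : Fin d → ℤ =>
      Real.exp (2 * lam * ∑ k, ((j k : ℝ) ^ 2)) * ‖u j 1‖ ^ 2 := by
    refine Summable.of_nonneg_of_le (fun j => by positivity) (fun j => ?_) hdecay
    gcongr
    linarith [sq_nonneg ‖u j 0‖]
  -- exponential weights
  let H : (Fin d → ℝ) → ℝ → ENNReal := fun y s =>
    ∑' j, ENNReal.ofReal (latW d y j ^ 2) * ENNReal.ofReal (‖u j s‖ ^ 2)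
  have hH : ∀ y, H y t ≤ H y 0 ^ (1 - t) * H y 1 ^ t := by
    intro y
    have hv : Summable fun j => ‖(latW d y j : ℂ) * u j 0‖ ^ 2 := by
      refine Summable.of_nonneg_of_le (fun j => by positivity) (fun j => ?_)
        (hs0.mul_left (Real.exp (∑ k, y k ^ 2 / (2 * lam))))
      rw [norm_mul, mul_pow, Complex.norm_real, Real.norm_eq_abs, sq_abs, ← mul_assoc]
      gcongr
      exact latW_sq_le d lam hlam y j
    let v : LatH (Fin d → ℤ) := ⟨fun j => (latW d y j : ℂ) * u j 0, latH_memlp hv⟩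
    have hvw : ∀ j, v j = (latW d y j : ℂ) * w 0 j := fun j => by rw [hw 0 h0m]
    have hve : ∀ s ∈ Set.Icc (0:ℝ) 1, ∀ j,
        NormedSpace.exp (s • latB d y) v j = (latW d y j : ℂ) * u j s := by
      intro s hs j
      rw [latB_exp_conj d y (w 0) v hvw s j, ← hsol s hs, hw s hs]
    have hHn : ∀ s ∈ Set.Icc (0:ℝ) 1,
        H y s = ENNReal.ofReal (‖NormedSpace.exp (s • latB d y) v‖ ^ 2) := by
      intro s hs
      rw [latH_ofReal_norm_sq]
      refine tsum_congr fun j => ?_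
      rw [hve s hs j, norm_mul, mul_pow, Complex.norm_real, Real.norm_eq_abs, sq_abs,
        ENNReal.ofReal_mul (by positivity)]
    have key := normal_exp_interp (latB d y) (latB_normal d y) v t ht
    rw [hHn t ht, hHn 0 h0m, hHn 1 h1m, zero_smul, one_smul, NormedSpace.exp_zero,
      one_apply_eq_self, ENNReal.ofReal_rpow_of_nonneg (by positivity) (by linarith [ht.2]),
      ENNReal.ofReal_rpow_of_nonneg (by positivity) ht.1, ← ENNReal.ofReal_mul (by positivity)]
    refine ENNReal.ofReal_le_ofReal ?_
    calc _ ≤ (‖v‖ ^ (1 - t) * ‖NormedSpace.exp (latB d y) v‖ ^ t) ^ 2 :=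
          pow_le_pow_left₀ (norm_nonneg _) key 2
      _ = _ := by
        rw [mul_pow, ← Real.rpow_mul_natCast (norm_nonneg _),
          ← Real.rpow_mul_natCast (norm_nonneg _), ← Real.rpow_natCast_mul (norm_nonneg _),
          ← Real.rpow_natCast_mul (norm_nonneg _), mul_comm (1 - t), mul_comm t]
  -- average over Gaussian `y`
  let lam' : NNReal := ⟨lam, hlam.le⟩
  let μ : Measure (Fin d → ℝ) := Measure.pi fun _ : Fin d => gaussianReal 0 lam'
  have hWm : ∀ j, Measurable fun y : Fin d → ℝ => latW d y j := by
    intro j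
    unfold latW
    fun_prop
  have hHm : ∀ s, Measurable fun y => H y s := by
    intro s
    refine Measurable.ennreal_tsum fun j => ?_
    exact (((hWm j).pow_const 2).ennreal_ofReal).mul_const _
  have hHi : ∀ s, ∫⁻ y, H y s ∂μ
      = ∑' j, ENNReal.ofReal (Real.exp (2 * lam * ∑ k, ((j k : ℝ) ^ 2)) * ‖u j s‖ ^ 2) := by
    intro s
    rw [lintegral_tsum (fun j => ((((hWm j).pow_const 2).ennreal_ofReal).mul_const _).aemeasurable)]
    refine tsum_congr fun j => ?_
    rw [lintegral_mul_const _ (((hWm j).pow_const 2).ennreal_ofReal), latW_gauss,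
      ENNReal.ofReal_mul (by positivity)]
    rfl
  have hmain : ∫⁻ y, H y t ∂μ ≤ (∫⁻ y, H y 0 ∂μ) ^ (1 - t) * (∫⁻ y, H y 1 ∂μ) ^ t :=
    (lintegral_mono hH).trans (ENNReal.lintegral_mul_norm_pow_le (hHm 0).aemeasurable
      (hHm 1).aemeasurable (by linarith [ht.2]) ht.1 (by ring))
  rw [hHi, hHi, hHi, ← ENNReal.ofReal_tsum_of_nonneg (fun j => by positivity) hs0,
    ← ENNReal.ofReal_tsum_of_nonneg (fun j => by positivity) hs1,
    ENNReal.ofReal_rpow_of_nonneg (tsum_nonneg fun j => by positivity) (by linarith [ht.2]),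
    ENNReal.ofReal_rpow_of_nonneg (tsum_nonneg fun j => by positivity) ht.1,
    ← ENNReal.ofReal_mul (Real.rpow_nonneg (tsum_nonneg fun j => by positivity) _)] at hmain
  have hR : 0 ≤ (∑' j : Fin d → ℤ, Real.exp (2 * lam * ∑ k, ((j k : ℝ) ^ 2)) * ‖u j 0‖ ^ 2) ^ (1 - t) *
        (∑' j : Fin d → ℤ, Real.exp (2 * lam * ∑ k, ((j k : ℝ) ^ 2)) * ‖u j 1‖ ^ 2) ^ t :=
    mul_nonneg (Real.rpow_nonneg (tsum_nonneg fun j => by positivity) _)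
      (Real.rpow_nonneg (tsum_nonneg fun j => by positivity) _)
  by_cases hst : Summable fun j : Fin d → ℤ =>
      Real.exp (2 * lam * ∑ k, ((j k : ℝ) ^ 2)) * ‖u j t‖ ^ 2
  · rw [← ENNReal.ofReal_tsum_of_nonneg (fun j => by positivity) hst,
      ENNReal.ofReal_le_ofReal_iff hR] at hmain
    exact hmain
  · rw [tsum_eq_zero_of_not_summable hst]
    exact hR
end
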